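/- arXiv:2501.12227 — 2 statements merged into one kernel-verified Lean document; each statement's English description precedes it below -/
import Mathlib

section
/- Let (Y,U₁,X̃₁,X₁,U₂,X̃₂,X₂) be finite-valued random variables such that (U₁,X̃₁,X₁) is independent of (U₂,X̃₂,X₂) and the Markov chain Y → (U₁,X̃₁,U₂,X̃₂) → (X₁,X₂) holds (equivalently I(Y;X₁,X₂|U₁,X̃₁,U₂,X̃₂) = 0). Then the Markov chain Y → (X₁,U₂,X̃₂) → X₂ holds, i.e., I(Y;X₂|X₁,U₂,X̃₂) = 0. -/
open scoped BigOperators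

noncomputable section

/-- `p` is a probability mass function on the finite type `α`. -/
def IsPMF {α : Type*} [Fintype α] (p : α → ℝ) : Prop :=
  (∀ a, 0 ≤ p a) ∧ ∑ a, p a = 1

/-- `k` is a stochastic kernel from `α` to the finite type `β`. -/
def IsKernel {α β : Type*} [Fintype β] (k : α → β → ℝ) : Prop :=
  ∀ a, (∀ b, 0 ≤ k a b) ∧ ∑ b, k a b = 1

/-- Distribution (pushforward pmf) of the random variable `X` under the pmf `μ`. -/
def rvDist {Ω α : Type*} [Fintype Ω] [DecidableEq α] (μ : Ω → ℝ) (X : Ω → α) : α → ℝ :=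
  fun a => ∑ ω, if X ω = a then μ ω else 0

/-- Shannon entropy in bits of a pmf on a finite type. -/
def entBits {α : Type*} [Fintype α] (p : α → ℝ) : ℝ :=
  (∑ a, Real.negMulLog (p a)) / Real.log 2

/-- Entropy (in bits) of a random variable `X` under the pmf `μ`. -/
def Hb {Ω α : Type*} [Fintype Ω] [Fintype α] [DecidableEq α] (μ : Ω → ℝ) (X : Ω → α) : ℝ :=
  entBits (rvDist μ X)

/-- Conditional entropy (in bits) `H(X | Z)`. -/
def condHb {Ω α γ : Type*} [Fintype Ω] [Fintype α] [Fintype γ] [DecidableEq α] [DecidableEq γ]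
    (μ : Ω → ℝ) (X : Ω → α) (Z : Ω → γ) : ℝ :=
  Hb μ (fun ω => (X ω, Z ω)) - Hb μ Z

/-- Mutual information (in bits) `I(X; Y)`. -/
def Ib {Ω α β : Type*} [Fintype Ω] [Fintype α] [Fintype β] [DecidableEq α] [DecidableEq β]
    (μ : Ω → ℝ) (X : Ω → α) (Y : Ω → β) : ℝ :=
  Hb μ X + Hb μ Y - Hb μ (fun ω => (X ω, Y ω))

/-- Conditional mutual information (in bits) `I(X; Y | Z)`. -/
def condIb {Ω α β γ : Type*} [Fintype Ω] [Fintype α] [Fintype β] [Fintype γ]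
    [DecidableEq α] [DecidableEq β] [DecidableEq γ]
    (μ : Ω → ℝ) (X : Ω → α) (Y : Ω → β) (Z : Ω → γ) : ℝ :=
  Hb μ (fun ω => (X ω, Z ω)) + Hb μ (fun ω => (Y ω, Z ω))
    - Hb μ (fun ω => (X ω, Y ω, Z ω)) - Hb μ Z

section helpers
variable {Ω α β γ δ : Type*} [Fintype Ω] [Fintype α] [Fintype β] [Fintype γ] [Fintype δ]
  [DecidableEq α] [DecidableEq β] [DecidableEq γ] [DecidableEq δ]

lemma rv_nonneg (μ : Ω → ℝ) (hμ : ∀ a, 0 ≤ μ a) (X : Ω → α) (a : α) : 0 ≤ rvDist μ X a :=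
  Finset.sum_nonneg fun ω _ => by split_ifs <;> simp [hμ]

lemma rv_pos (μ : Ω → ℝ) (hμ : ∀ a, 0 ≤ μ a) (X : Ω → α) (ω : Ω) (h : 0 < μ ω) :
    0 < rvDist μ X (X ω) := by
  refine Finset.sum_pos' (fun ω _ => by split_ifs <;> simp [hμ]) ⟨ω, Finset.mem_univ _, ?_⟩
  simpa using h

lemma rv_sum (μ : Ω → ℝ) (X : Ω → α) (g : α → ℝ) :
    ∑ a, rvDist μ X a * g a = ∑ ω, μ ω * g (X ω) := by
  simp only [rvDist, Finset.sum_mul]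
  rw [Finset.sum_comm]
  refine Finset.sum_congr rfl fun ω _ => ?_
  simp [ite_mul]

lemma Hb_eq (μ : Ω → ℝ) (X : Ω → α) :
    Hb μ X = (∑ ω, μ ω * (- Real.log (rvDist μ X (X ω)))) / Real.log 2 := by
  rw [Hb, entBits, ← rv_sum μ X (fun a => - Real.log (rvDist μ X a))]
  congr 1
  refine Finset.sum_congr rfl fun a _ => ?_
  simp [Real.negMulLog]

lemma Hb_congr (μ : Ω → ℝ) (X : Ω → α) (Y : Ω → β)
    (h : ∀ ω ω', X ω = X ω' ↔ Y ω = Y ω') : Hb μ X = Hb μ Y := by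
  rw [Hb_eq, Hb_eq]
  simp only [rvDist, h]

lemma rv_fst (μ : Ω → ℝ) (X : Ω → α) (Z : Ω → γ) (z : γ) :
    ∑ x, rvDist μ (fun ω => (X ω, Z ω)) (x, z) = rvDist μ Z z := by
  simp only [rvDist]
  rw [Finset.sum_comm]
  refine Finset.sum_congr rfl fun ω _ => ?_
  by_cases h : Z ω = z <;> simp [h]

lemma condIb_nonneg (μ : Ω → ℝ) (hμ : IsPMF μ) (X : Ω → α) (Y : Ω → β) (Z : Ω → γ) :
    0 ≤ condIb μ X Y Z := by
  have h0 := hμ.1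
  rw [condIb, Hb_eq, Hb_eq, Hb_eq, Hb_eq, ← add_div, ← sub_div, ← sub_div]
  refine div_nonneg ?_ (Real.log_nonneg (by norm_num))
  rw [← Finset.sum_add_distrib, ← Finset.sum_sub_distrib, ← Finset.sum_sub_distrib]
  set p := rvDist μ (fun ω => (X ω, Y ω, Z ω)) with hp
  set q := rvDist μ (fun ω => (X ω, Z ω)) with hq
  set r := rvDist μ (fun ω => (Y ω, Z ω)) with hr
  set s := rvDist μ Z with hs
  have key : ∀ ω, μ ω * 1 - μ ω * (q (X ω, Z ω) * r (Y ω, Z ω) / s (Z ω) / p (X ω, Y ω, Z ω)) ≤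
      μ ω * -Real.log (q (X ω, Z ω)) + μ ω * -Real.log (r (Y ω, Z ω)) -
        μ ω * -Real.log (p (X ω, Y ω, Z ω)) - μ ω * -Real.log (s (Z ω)) := by
    intro ω
    rcases (h0 ω).eq_or_lt with h | h
    · simp [← h]
    have hp1 := rv_pos μ h0 (fun ω => (X ω, Y ω, Z ω)) ω h
    have hq1 := rv_pos μ h0 (fun ω => (X ω, Z ω)) ω h
    have hr1 := rv_pos μ h0 (fun ω => (Y ω, Z ω)) ω h
    have hs1 := rv_pos μ h0 Z ω h
    simp only [← hp, ← hq, ← hr, ← hs] at hp1 hq1 hr1 hs1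
    have := Real.log_le_sub_one_of_pos (x := q (X ω, Z ω) * r (Y ω, Z ω) / s (Z ω) / p (X ω, Y ω, Z ω)) (by positivity)
    rw [Real.log_div (by positivity) hp1.ne', Real.log_div (by positivity) hs1.ne',
      Real.log_mul hq1.ne' hr1.ne'] at this
    nlinarith
  refine le_trans ?_ (Finset.sum_le_sum fun ω _ => key ω)
  rw [Finset.sum_sub_distrib, ← rv_sum μ (fun ω => (X ω, Y ω, Z ω))
    (fun t => q (t.1, t.2.2) * r (t.2.1, t.2.2) / s t.2.2 / p t)]
  have h1 : ∑ ω, μ ω * 1 = 1 := by simpa using hμ.2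
  rw [h1, sub_nonneg]
  have hsum : ∑ t : α × β × γ, q (t.1, t.2.2) * r (t.2.1, t.2.2) / s t.2.2 = 1 := by
    have e : ∀ t : γ, ∑ x, ∑ y, q (x, t) * r (y, t) / s t = s t := by
      intro t
      simp only [← Finset.sum_div, ← Finset.mul_sum, ← Finset.sum_mul]
      rw [hq, hr, rv_fst, rv_fst, ← hs]
      simp
    rw [Fintype.sum_prod_type]
    simp only [Fintype.sum_prod_type]
    have : ∀ x, ∑ y, ∑ t, q (x, t) * r (y, t) / s t = ∑ t, ∑ y, q (x, t) * r (y, t) / s t :=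
      fun x => Finset.sum_comm
    simp only [this]
    rw [Finset.sum_comm]
    simp only [e]
    have := rv_sum μ Z (fun _ => 1)
    rw [h1] at this
    simpa using this
  rw [← hsum]
  refine Finset.sum_le_sum fun t _ => ?_
  rw [← hp]
  have hn : 0 ≤ q (t.1, t.2.2) * r (t.2.1, t.2.2) / s t.2.2 :=
    div_nonneg (mul_nonneg (rv_nonneg μ h0 _ _) (rv_nonneg μ h0 _ _)) (rv_nonneg μ h0 _ _)
  by_cases h : p t = 0
  · simpa [h] using hn
  · exact (mul_div_cancel₀ _ h).le

lemma rv_comp (μ : Ω → ℝ) (X : Ω → α) (f : α → γ) (c : γ) :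
    rvDist μ (fun ω => f (X ω)) c = ∑ a, rvDist μ X a * if f a = c then 1 else 0 := by
  rw [rv_sum]; simp [rvDist]

/-- Additivity of entropy for functions of independent variables. -/
lemma Hb_indep (μ : Ω → ℝ) (hμ : IsPMF μ) (S : Ω → α) (T : Ω → β)
    (h : ∀ a b, rvDist μ (fun ω => (S ω, T ω)) (a, b) = rvDist μ S a * rvDist μ T b)
    (f : α → γ) (g : β → δ) :
    Hb μ (fun ω => (f (S ω), g (T ω))) = Hb μ (fun ω => f (S ω)) + Hb μ (fun ω => g (T ω)) := by
  have h0 := hμ.1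
  have hfg : ∀ c d, rvDist μ (fun ω => (f (S ω), g (T ω))) (c, d) =
      rvDist μ (fun ω => f (S ω)) c * rvDist μ (fun ω => g (T ω)) d := by
    intro c d
    rw [rv_comp μ (fun ω => (S ω, T ω)) (fun t => (f t.1, g t.2)), rv_comp μ S f, rv_comp μ T g,
      Finset.sum_mul_sum, Fintype.sum_prod_type]
    refine Finset.sum_congr rfl fun a _ => Finset.sum_congr rfl fun b _ => ?_
    rw [h]
    by_cases h1 : f a = c <;> by_cases h2 : g b = d <;> simp [h1, h2]
  rw [Hb_eq, Hb_eq, Hb_eq, ← add_div, ← Finset.sum_add_distrib]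
  congr 1
  refine Finset.sum_congr rfl fun ω _ => ?_
  rcases (h0 ω).eq_or_lt with hw | hw
  · simp [← hw]
  rw [hfg, Real.log_mul (rv_pos μ h0 (fun ω => f (S ω)) ω hw).ne'
    (rv_pos μ h0 (fun ω => g (T ω)) ω hw).ne']
  ring

end helpers

/-- If `(U₁, X̃₁, X₁)` is independent of `(U₂, X̃₂, X₂)` and the Markov chain
`Y → (U₁, X̃₁, U₂, X̃₂) → (X₁, X₂)` holds (`I(Y; X₁, X₂ | U₁, X̃₁, U₂, X̃₂) = 0`), then the
Markov chain `Y → (X₁, U₂, X̃₂) → X₂` holds, i.e. `I(Y; X₂ | X₁, U₂, X̃₂) = 0`. -/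
theorem markov_chain_transfer
    {Ω Ya U1 Xt1 X1 U2 Xt2 X2 : Type*} [Fintype Ω]
    [Fintype Ya] [Fintype U1] [Fintype Xt1] [Fintype X1] [Fintype U2] [Fintype Xt2]
    [Fintype X2]
    [DecidableEq Ya] [DecidableEq U1] [DecidableEq Xt1] [DecidableEq X1] [DecidableEq U2]
    [DecidableEq Xt2] [DecidableEq X2]
    (μ : Ω → ℝ) (hμ : IsPMF μ)
    (Yv : Ω → Ya) (U1v : Ω → U1) (Xt1v : Ω → Xt1) (X1v : Ω → X1)
    (U2v : Ω → U2) (Xt2v : Ω → Xt2) (X2v : Ω → X2)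
    -- `(U₁, X̃₁, X₁)` is independent of `(U₂, X̃₂, X₂)`
    (hindep : ∀ (a : U1 × Xt1 × X1) (b : U2 × Xt2 × X2),
      rvDist μ (fun ω => ((U1v ω, Xt1v ω, X1v ω), (U2v ω, Xt2v ω, X2v ω))) (a, b) =
        rvDist μ (fun ω => (U1v ω, Xt1v ω, X1v ω)) a *
          rvDist μ (fun ω => (U2v ω, Xt2v ω, X2v ω)) b)
    -- Markov chain `Y → (U₁, X̃₁, U₂, X̃₂) → (X₁, X₂)`
    (hmc : condIb μ Yv (fun ω => (X1v ω, X2v ω))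
      (fun ω => (U1v ω, Xt1v ω, U2v ω, Xt2v ω)) = 0) :
    condIb μ Yv X2v (fun ω => (X1v ω, U2v ω, Xt2v ω)) = 0 := by
  have n1 := condIb_nonneg μ hμ Yv X2v (fun ω => (X1v ω, U2v ω, Xt2v ω))
  have n2 := condIb_nonneg μ hμ (fun ω => (U1v ω, Xt1v ω)) X2v
    (fun ω => (Yv ω, X1v ω, U2v ω, Xt2v ω))
  have n3 := condIb_nonneg μ hμ Yv X1v (fun ω => (U1v ω, Xt1v ω, U2v ω, Xt2v ω))
  have i1 := Hb_indep μ hμ _ _ hindep (fun a => a) (fun b => (b.1, b.2.1))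
  have i2 := Hb_indep μ hμ _ _ hindep (fun a => a.2.2) (fun b => b)
  have i3 := Hb_indep μ hμ _ _ hindep (fun a => a) (fun b => b)
  have i4 := Hb_indep μ hμ _ _ hindep (fun a => a.2.2) (fun b => (b.1, b.2.1))
  refine le_antisymm ?_ n1
  simp only [condIb] at *
  -- H(A X1 B), H(X1 B X2), H(all but Y), H(X1 B)
  have c1 : Hb μ (fun ω => (X1v ω, U1v ω, Xt1v ω, U2v ω, Xt2v ω)) =
      Hb μ (fun ω => ((U1v ω, Xt1v ω, X1v ω), (U2v ω, Xt2v ω))) :=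
    Hb_congr _ _ _ (by intros; simp only [Prod.mk.injEq]; tauto)
  have c2 : Hb μ (fun ω => (X2v ω, X1v ω, U2v ω, Xt2v ω)) =
      Hb μ (fun ω => (X1v ω, (U2v ω, Xt2v ω, X2v ω))) :=
    Hb_congr _ _ _ (by intros; simp only [Prod.mk.injEq]; tauto)
  have c3 : Hb μ (fun ω => ((X1v ω, X2v ω), U1v ω, Xt1v ω, U2v ω, Xt2v ω)) =
      Hb μ (fun ω => ((U1v ω, Xt1v ω, X1v ω), (U2v ω, Xt2v ω, X2v ω))) :=
    Hb_congr _ _ _ (by intros; simp only [Prod.mk.injEq]; tauto)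
  have c5 : Hb μ (fun ω => ((U1v ω, Xt1v ω), Yv ω, X1v ω, U2v ω, Xt2v ω)) =
      Hb μ (fun ω => (Yv ω, X1v ω, U1v ω, Xt1v ω, U2v ω, Xt2v ω)) :=
    Hb_congr _ _ _ (by intros; simp only [Prod.mk.injEq]; tauto)
  have c6 : Hb μ (fun ω => (X2v ω, Yv ω, X1v ω, U2v ω, Xt2v ω)) =
      Hb μ (fun ω => (Yv ω, X2v ω, X1v ω, U2v ω, Xt2v ω)) :=
    Hb_congr _ _ _ (by intros; simp only [Prod.mk.injEq]; tauto)
  set_option synthInstance.maxSize 2000 in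
  set_option synthInstance.maxHeartbeats 200000 in
  have c7 : Hb μ (fun ω => ((U1v ω, Xt1v ω), X2v ω, Yv ω, X1v ω, U2v ω, Xt2v ω)) =
      Hb μ (fun ω => (Yv ω, (X1v ω, X2v ω), U1v ω, Xt1v ω, U2v ω, Xt2v ω)) :=
    Hb_congr _ _ _ (by intros; simp only [Prod.mk.injEq]; tauto)
  linarith
end
end

section
/- Let (X₁ᵢ, Wᵢ), i=1,…,n, be i.i.d. finite-valued random pairs, let K₁ be a finite-valued random variable independent of (X₁ⁿ, Wⁿ), and let Ỹ₁ⁿ = (Ỹ₁₁,…,Ỹ₁ₙ) be any finite-valued random vector jointly distributed with (K₁, X₁ⁿ, Wⁿ). Then Σ_{i=1}^n H(Ỹ₁ᵢ|Wᵢ) ≥ Σ_{i=1}^n I(K₁, Ỹ₁_{∼i}, W_{∼i}, Ỹ₁ᵢ ; X₁ᵢ | Wᵢ), where Ỹ₁_{∼i} and W_{∼i} denote all coordinates of Ỹ₁ⁿ and Wⁿ except the i-th. Consequently, with T uniform on {1,…,n} independent of all other variables, and U₁ := (K₁, Ỹ₁_{∼T}, W_{∼T}), one has H(Ỹ₁_T|W_T,T)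 ≥ I(U₁, Ỹ₁_T ; X₁_T | W_T, T). -/
open scoped BigOperators

set_option synthInstance.maxSize 512

noncomputable section

/-- Shannon entropy (natural logarithm) of a pmf on a finite type. -/
def ent {α : Type*} [Fintype α] (p : α → ℝ) : ℝ := ∑ a, Real.negMulLog (p a)

/-- Entropy of a random variable `X` under the pmf `μ`. -/
def H {Ω α : Type*} [Fintype Ω] [Fintype α] [DecidableEq α] (μ : Ω → ℝ) (X : Ω → α) : ℝ :=
  ent (rvDist μ X)

/-- Conditional entropy `H(X | Z)`. -/
def condH {Ω α γ : Type*} [Fintype Ω] [Fintype α] [Fintype γ] [DecidableEq α] [DecidableEq γ]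
    (μ : Ω → ℝ) (X : Ω → α) (Z : Ω → γ) : ℝ :=
  H μ (fun ω => (X ω, Z ω)) - H μ Z

/-- Mutual information `I(X; Y)`. -/
def mutI {Ω α β : Type*} [Fintype Ω] [Fintype α] [Fintype β] [DecidableEq α] [DecidableEq β]
    (μ : Ω → ℝ) (X : Ω → α) (Y : Ω → β) : ℝ :=
  H μ X + H μ Y - H μ (fun ω => (X ω, Y ω))

/-- Conditional mutual information `I(X; Y | Z)`. -/
def condI {Ω α β γ : Type*} [Fintype Ω] [Fintype α] [Fintype β] [Fintype γ]
    [DecidableEq α] [DecidableEq β] [DecidableEq γ]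
    (μ : Ω → ℝ) (X : Ω → α) (Y : Ω → β) (Z : Ω → γ) : ℝ :=
  H μ (fun ω => (X ω, Z ω)) + H μ (fun ω => (Y ω, Z ω))
    - H μ (fun ω => (X ω, Y ω, Z ω)) - H μ Z

section Helpers

variable {Ω : Type*} [Fintype Ω]

lemma rvDist_nonneg {α : Type*} [DecidableEq α] {μ : Ω → ℝ} (h0 : ∀ ω, 0 ≤ μ ω) (X : Ω → α)
    (a : α) : 0 ≤ rvDist μ X a := by
  unfold rvDist
  refine Finset.sum_nonneg fun ω _ => ?_
  split_ifs
  · exact h0 ω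
  · exact le_rfl

lemma le_rvDist {α : Type*} [DecidableEq α] {μ : Ω → ℝ} (h0 : ∀ ω, 0 ≤ μ ω) (X : Ω → α)
    (ω : Ω) : μ ω ≤ rvDist μ X (X ω) := by
  unfold rvDist
  have := Finset.single_le_sum (f := fun ω' => if X ω' = X ω then μ ω' else 0)
    (fun ω' _ => by
      show 0 ≤ if X ω' = X ω then μ ω' else 0
      split_ifs
      · exact h0 ω'
      · exact le_rfl) (Finset.mem_univ ω)
  simpa using this

lemma rvDist_sum_mul {α : Type*} [Fintype α] [DecidableEq α] (μ : Ω → ℝ) (X : Ω → α)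
    (g : α → ℝ) : ∑ a, rvDist μ X a * g a = ∑ ω, μ ω * g (X ω) := by
  unfold rvDist
  simp_rw [Finset.sum_mul]
  rw [Finset.sum_comm]
  refine Finset.sum_congr rfl fun ω _ => ?_
  simp

lemma H_eq {α : Type*} [Fintype α] [DecidableEq α] (μ : Ω → ℝ) (X : Ω → α) :
    H μ X = ∑ ω, μ ω * (-Real.log (rvDist μ X (X ω))) := by
  rw [← rvDist_sum_mul μ X (fun a => -Real.log (rvDist μ X a))]
  unfold H ent Real.negMulLog
  refine Finset.sum_congr rfl fun a _ => by ring

lemma H_mono {α β : Type*} [Fintype α] [DecidableEq α] [Fintype β] [DecidableEq β] {μ : Ω → ℝ}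
    (h0 : ∀ ω, 0 ≤ μ ω) (X : Ω → α) (Y : Ω → β) (h : ∀ ω ω', Y ω = Y ω' → X ω = X ω') :
    H μ X ≤ H μ Y := by
  rw [H_eq, H_eq]
  refine Finset.sum_le_sum fun ω _ => ?_
  rcases (h0 ω).eq_or_lt with h1 | h1
  · simp [← h1]
  · refine mul_le_mul_of_nonneg_left (neg_le_neg ?_) (h0 ω)
    refine Real.log_le_log (h1.trans_le (le_rvDist h0 Y ω)) ?_
    unfold rvDist
    refine Finset.sum_le_sum fun ω' _ => ?_
    by_cases h2 : Y ω' = Y ω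
    · simp [h2, h _ _ h2]
    · simp only [h2, if_false]
      split_ifs
      · exact h0 ω'
      · exact le_rfl

lemma H_congr {α β : Type*} [Fintype α] [DecidableEq α] [Fintype β] [DecidableEq β] {μ : Ω → ℝ}
    (h0 : ∀ ω, 0 ≤ μ ω) (X : Ω → α) (Y : Ω → β) (h : ∀ ω ω', Y ω = Y ω' ↔ X ω = X ω') :
    H μ X = H μ Y :=
  le_antisymm (H_mono h0 X Y fun _ _ => (h _ _).1) (H_mono h0 Y X fun _ _ => (h _ _).2)

lemma gibbs {α : Type*} [Fintype α] [DecidableEq α] {μ : Ω → ℝ} (hμ : IsPMF μ) (X : Ω → α)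
    (r : α → ℝ) (hr0 : ∀ a, 0 ≤ r a) (hr1 : ∑ a, r a ≤ 1)
    (hpos : ∀ ω, 0 < μ ω → 0 < r (X ω)) :
    H μ X ≤ ∑ ω, μ ω * (-Real.log (r (X ω))) := by
  have h0 := hμ.1
  rw [H_eq]
  have key : ∀ ω, μ ω * (-Real.log (rvDist μ X (X ω))) ≤
      μ ω * (-Real.log (r (X ω))) + (μ ω * (r (X ω) / rvDist μ X (X ω)) - μ ω) := by
    intro ω
    rcases (h0 ω).eq_or_lt with h1 | h1
    · simp [← h1]
    · have hP := h1.trans_le (le_rvDist h0 X ω)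
      have hR := hpos ω h1
      have := Real.log_le_sub_one_of_pos (div_pos hR hP)
      rw [Real.log_div hR.ne' hP.ne'] at this
      nlinarith
  refine (Finset.sum_le_sum fun ω _ => key ω).trans ?_
  rw [Finset.sum_add_distrib, Finset.sum_sub_distrib, hμ.2,
    ← rvDist_sum_mul μ X (fun a => r a / rvDist μ X a)]
  have : ∑ a, rvDist μ X a * (r a / rvDist μ X a) ≤ ∑ a, r a := by
    refine Finset.sum_le_sum fun a _ => ?_
    by_cases h : rvDist μ X a = 0
    · simp [h, hr0 a]
    · rw [mul_div_cancel₀ _ h]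
  linarith

lemma rvDist_marg {α γ : Type*} [Fintype α] [DecidableEq α] [DecidableEq γ]
    (μ : Ω → ℝ) (A : Ω → α) (C : Ω → γ) (c : γ) :
    ∑ a, rvDist μ (fun ω => (A ω, C ω)) (a, c) = rvDist μ C c := by
  unfold rvDist
  rw [Finset.sum_comm]
  refine Finset.sum_congr rfl fun ω _ => ?_
  simp only [Prod.mk.injEq]
  by_cases h : C ω = c <;> simp [h]

lemma rvDist_total {γ : Type*} [Fintype γ] [DecidableEq γ]
    {μ : Ω → ℝ} (hμ : IsPMF μ) (C : Ω → γ) : ∑ c, rvDist μ C c = 1 := by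
  have := rvDist_sum_mul μ C (fun _ => 1)
  simpa [hμ.2] using this

lemma ssa {α β γ : Type*} [Fintype α] [DecidableEq α] [Fintype β] [DecidableEq β]
    [Fintype γ] [DecidableEq γ] {μ : Ω → ℝ} (hμ : IsPMF μ)
    (A : Ω → α) (B : Ω → β) (C : Ω → γ) :
    H μ (fun ω => (A ω, B ω, C ω)) + H μ C ≤
      H μ (fun ω => (A ω, C ω)) + H μ (fun ω => (B ω, C ω)) := by
  have h0 := hμ.1
  have g := gibbs hμ (fun ω => (A ω, B ω, C ω))
    (fun x => rvDist μ (fun ω => (A ω, C ω)) (x.1, x.2.2) *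
      rvDist μ (fun ω => (B ω, C ω)) (x.2.1, x.2.2) / rvDist μ C x.2.2)
    (fun x => div_nonneg (mul_nonneg (rvDist_nonneg h0 _ _) (rvDist_nonneg h0 _ _))
      (rvDist_nonneg h0 _ _))
    (by
      simp only [Fintype.sum_prod_type]
      rw [Finset.sum_comm]
      have e : ∀ b : β, ∑ a : α, ∑ c : γ, rvDist μ (fun ω => (A ω, C ω)) (a, c) *
          rvDist μ (fun ω => (B ω, C ω)) (b, c) / rvDist μ C c =
          ∑ c : γ, rvDist μ C c * rvDist μ (fun ω => (B ω, C ω)) (b, c) / rvDist μ C c := by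
        intro b
        rw [Finset.sum_comm]
        refine Finset.sum_congr rfl fun c _ => ?_
        rw [← Finset.sum_div, ← Finset.sum_mul, rvDist_marg]
      simp_rw [e]
      rw [Finset.sum_comm]
      rw [← rvDist_total hμ C]
      refine Finset.sum_le_sum fun c _ => ?_
      rw [← Finset.sum_div, ← Finset.mul_sum, rvDist_marg]
      by_cases h : rvDist μ C c = 0
      · simp [h]
      · rw [mul_div_cancel_right₀ _ h])
    (fun ω hω => div_pos (mul_pos (hω.trans_le (le_rvDist h0 (fun ω => (A ω, C ω)) ω))
      (hω.trans_le (le_rvDist h0 (fun ω => (B ω, C ω)) ω))) (hω.trans_le (le_rvDist h0 C ω)))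
  have e : ∑ ω, μ ω * (-Real.log (rvDist μ (fun ω => (A ω, C ω)) (A ω, C ω) *
      rvDist μ (fun ω => (B ω, C ω)) (B ω, C ω) / rvDist μ C (C ω))) =
      H μ (fun ω => (A ω, C ω)) + H μ (fun ω => (B ω, C ω)) - H μ C := by
    rw [H_eq, H_eq, H_eq, ← Finset.sum_add_distrib, ← Finset.sum_sub_distrib]
    refine Finset.sum_congr rfl fun ω _ => ?_
    rcases (h0 ω).eq_or_lt with h1 | h1
    · simp [← h1]
    · have hA := h1.trans_le (le_rvDist h0 (fun ω => (A ω, C ω)) ω)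
      have hB := h1.trans_le (le_rvDist h0 (fun ω => (B ω, C ω)) ω)
      have hC := h1.trans_le (le_rvDist h0 C ω)
      rw [Real.log_div (mul_pos hA hB).ne' hC.ne', Real.log_mul hA.ne' hB.ne']
      ring
  simp only at g
  linarith

lemma H_unit {μ : Ω → ℝ} (hμ : IsPMF μ) : H μ (fun _ => ()) = 0 := by
  rw [H_eq]
  simp [rvDist, hμ.2]

lemma chain {ι α γ : Type*} [Fintype ι] [DecidableEq ι] [Fintype α] [DecidableEq α]
    [Fintype γ] [DecidableEq γ] {μ : Ω → ℝ} (hμ : IsPMF μ) (A : ι → Ω → α) (C : Ω → γ) :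
    H μ (fun ω => (fun j => A j ω, C ω)) - H μ C ≤
      ∑ j, (H μ (fun ω => (A j ω, C ω)) - H μ C) := by
  have h0 := hμ.1
  have key : ∀ s : Finset ι,
      H μ (fun ω => (fun j => if j ∈ s then some (A j ω) else none, C ω)) - H μ C ≤
      ∑ j ∈ s, (H μ (fun ω => (A j ω, C ω)) - H μ C) := by
    intro s
    induction s using Finset.induction_on with
    | empty =>
      simp only [Finset.sum_empty, sub_nonpos]
      refine H_mono h0 _ _ fun ω ω' h => ?_
      simp [h]
    | insert a s ha ih =>
      rw [Finset.sum_insert ha]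
      have h1 := ssa hμ (A a) (fun ω j => if j ∈ s then some (A j ω) else none) C
      have h2 : H μ (fun ω => (fun j => if j ∈ insert a s then some (A j ω) else none, C ω)) ≤
          H μ (fun ω => (A a ω, (fun j => if j ∈ s then some (A j ω) else none), C ω)) := by
        refine H_mono h0 _ _ fun ω ω' h => ?_
        simp only [Prod.mk.injEq] at h ⊢
        refine ⟨funext fun j => ?_, h.2.2⟩
        have h3 := congrFun h.2.1 j
        by_cases hj : j = a
        · subst hj; simp [h.1]
        · simpa [hj] using h3
      linarith
  refine le_trans (le_of_eq ?_) (key Finset.univ)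
  congr 1
  refine H_congr h0 _ _ fun ω ω' => ?_
  simp [funext_iff]

lemma H_time {α : Type*} [Fintype α] [DecidableEq α] {n : ℕ} (hn : 0 < n) {μ : Ω → ℝ}
    (hμ : IsPMF μ) (Z : Ω × Fin n → α) (hZ : ∀ z z', Z z = Z z' → z.2 = z'.2) :
    H (fun z : Ω × Fin n => μ z.1 / n) Z =
      Real.log n + (∑ i, H μ (fun ω => Z (ω, i))) / n := by
  have h0 := hμ.1
  have hn' : (n : ℝ) ≠ 0 := by positivity
  have hd : ∀ ω i, rvDist (fun z : Ω × Fin n => μ z.1 / n) Z (Z (ω, i)) =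
      rvDist μ (fun ω => Z (ω, i)) (Z (ω, i)) / n := by
    intro ω i
    unfold rvDist
    rw [Fintype.sum_prod_type, Finset.sum_div]
    refine Finset.sum_congr rfl fun ω' _ => ?_
    rw [Finset.sum_eq_single i]
    · split_ifs <;> simp
    · intro j _ hj
      rw [if_neg]
      intro h
      exact hj (hZ _ _ h)
    · simp
  have e : ∀ i, ∑ ω, μ ω / n * (-Real.log (rvDist μ (fun ω => Z (ω, i)) (Z (ω, i)) / n)) =
      (H μ (fun ω => Z (ω, i)) + Real.log n) / n := by
    intro i
    have : Real.log n = ∑ ω, μ ω * Real.log n := by rw [← Finset.sum_mul, hμ.2, one_mul]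
    rw [H_eq, this, ← Finset.sum_add_distrib, Finset.sum_div]
    refine Finset.sum_congr rfl fun ω _ => ?_
    rcases (h0 ω).eq_or_lt with h1 | h1
    · simp [← h1]
    · have hA := h1.trans_le (le_rvDist h0 (fun ω => Z (ω, i)) ω)
      rw [Real.log_div hA.ne' hn']
      ring
  rw [H_eq, Fintype.sum_prod_type_right]
  simp_rw [hd, e]
  rw [← Finset.sum_div, Finset.sum_add_distrib]
  simp
  field_simp
  ring

end Helpers

/-- Single-letterization step for the bound `H(Ỹ₁|W,T) ≥ I(U₁,Ỹ₁;X₁|W,T)` in the converse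
of Theorem 2: if `(X₁ᵢ, Wᵢ)` are i.i.d. and `K₁` is independent of `(X₁ⁿ, Wⁿ)`, then for
any `Ỹ₁ⁿ` jointly distributed with `(K₁, X₁ⁿ, Wⁿ)`,
`Σᵢ H(Ỹ₁ᵢ|Wᵢ) ≥ Σᵢ I(K₁, Ỹ₁_{∼i}, W_{∼i}, Ỹ₁ᵢ; X₁ᵢ | Wᵢ)`; consequently, with `T`
uniform on `{1,…,n}` independent of everything else and
`U₁ = (K₁, Ỹ₁_{∼T}, W_{∼T})` (the punctured vectors being encoded with `Option`),
`H(Ỹ₁_T | W_T, T) ≥ I(U₁, Ỹ₁_T; X₁_T | W_T, T)`. -/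
theorem converse_step_H_Y1_bound
    {Ω 𝒳 𝒲 𝒦 ℬ : Type*} [Fintype Ω] [Fintype 𝒳] [Fintype 𝒲] [Fintype 𝒦] [Fintype ℬ]
    [DecidableEq 𝒳] [DecidableEq 𝒲] [DecidableEq 𝒦] [DecidableEq ℬ]
    (n : ℕ) (hn : 0 < n)
    (μ : Ω → ℝ) (hμ : IsPMF μ)
    (X1v : Fin n → Ω → 𝒳) (Wv : Fin n → Ω → 𝒲) (K1 : Ω → 𝒦) (Ytv : Fin n → Ω → ℬ)
    (q : 𝒳 × 𝒲 → ℝ) (hq : IsPMF q)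
    -- the pairs `(X₁ᵢ, Wᵢ)` are i.i.d. with common pmf `q`
    (hiid : ∀ f : Fin n → 𝒳 × 𝒲,
      rvDist μ (fun ω => fun i => (X1v i ω, Wv i ω)) f = ∏ i, q (f i))
    -- `K₁` is independent of `(X₁ⁿ, Wⁿ)`
    (hindep : ∀ (a : 𝒦) (b : Fin n → 𝒳 × 𝒲),
      rvDist μ (fun ω => (K1 ω, fun i => (X1v i ω, Wv i ω))) (a, b) =
        rvDist μ K1 a * rvDist μ (fun ω => fun i => (X1v i ω, Wv i ω)) b) :
    (∑ i : Fin n, condH μ (Ytv i) (Wv i) ≥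
      ∑ i : Fin n,
        condI μ
          (fun ω => (K1 ω, fun j : {j : Fin n // j ≠ i} => Ytv j.1 ω,
            fun j : {j : Fin n // j ≠ i} => Wv j.1 ω, Ytv i ω))
          (X1v i) (Wv i)) ∧
    -- time-sharing formulation, on the extended space `Ω × Fin n` with `T = Prod.snd`
    (condH (fun z : Ω × Fin n => μ z.1 / n) (fun z => Ytv z.2 z.1)
        (fun z => (Wv z.2 z.1, z.2)) ≥
      condI (fun z : Ω × Fin n => μ z.1 / n)
        (fun z => ((K1 z.1,
            fun j : Fin n => if j = z.2 then none else some (Ytv j z.1),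
            fun j : Fin n => if j = z.2 then none else some (Wv j z.1)),
          Ytv z.2 z.1))
        (fun z => X1v z.2 z.1) (fun z => (Wv z.2 z.1, z.2))) := by
  have h0 := hμ.1
  set XW : Ω → Fin n → 𝒳 × 𝒲 := fun ω i => (X1v i ω, Wv i ω) with hXW
  have hpos : ∀ ω, 0 < μ ω → 0 < ∏ i, q (XW ω i) := fun ω hω => by
    rw [← hiid]; exact hω.trans_le (le_rvDist h0 XW ω)
  have part1 : ∑ i : Fin n, condI μ
          (fun ω => (K1 ω, fun j : {j : Fin n // j ≠ i} => Ytv j.1 ω,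
            fun j : {j : Fin n // j ≠ i} => Wv j.1 ω, Ytv i ω))
          (X1v i) (Wv i) ≤ ∑ i : Fin n, condH μ (Ytv i) (Wv i) := by
    -- sum of single-letter entropies
    have s1 : ∑ i, H μ (fun ω => (X1v i ω, Wv i ω)) ≤ H μ XW := by
      rw [H_eq μ XW]
      have : ∑ ω, μ ω * (-Real.log (rvDist μ XW (XW ω))) =
          ∑ i, ∑ ω, μ ω * (-Real.log (q (X1v i ω, Wv i ω))) := by
        rw [Finset.sum_comm]
        refine Finset.sum_congr rfl fun ω _ => ?_
        rw [← Finset.mul_sum, Finset.sum_neg_distrib, hiid]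
        rcases (h0 ω).eq_or_lt with h1 | h1
        · simp [← h1]
        · rw [Real.log_prod]
          intro i _ hi
          exact (hpos ω h1).ne' (Finset.prod_eq_zero (Finset.mem_univ i) hi)
      rw [this]
      refine Finset.sum_le_sum fun i _ => ?_
      refine gibbs hμ _ q hq.1 hq.2.le fun ω hω => ?_
      refine lt_of_le_of_ne (hq.1 _) fun hi => ?_
      exact (hpos ω hω).ne' (Finset.prod_eq_zero (Finset.mem_univ i) hi.symm)
    have s2 : H μ (fun ω => (K1 ω, XW ω)) = H μ K1 + H μ XW := by
      rw [H_eq, H_eq, H_eq, ← Finset.sum_add_distrib]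
      refine Finset.sum_congr rfl fun ω _ => ?_
      rw [hindep]
      rcases (h0 ω).eq_or_lt with h1 | h1
      · simp [← h1]
      · rw [Real.log_mul (h1.trans_le (le_rvDist h0 K1 ω)).ne'
          (h1.trans_le (le_rvDist h0 XW ω)).ne']
        ring
    let Wn : Ω → Fin n → 𝒲 := fun ω i => Wv i ω
    let Yn : Ω → Fin n → ℬ := fun ω i => Ytv i ω
    let V : Ω → 𝒦 × (Fin n → ℬ) × (Fin n → 𝒲) := fun ω => (K1 ω, Yn ω, Wn ω)
    have s3 : H μ Wn ≤ ∑ i, H μ (Wv i) := by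
      have := chain hμ Wv (fun _ => ())
      simp only [H_unit hμ, sub_zero] at this
      rw [H_congr h0 Wn (fun ω => (fun j => Wv j ω, ())) (by simp [Wn])]
      refine this.trans (Finset.sum_le_sum fun i _ => H_mono h0 _ _ (by simp))
    have s4 : H μ V ≤ H μ K1 + H μ (fun ω => (Yn ω, Wn ω)) := by
      have := ssa hμ K1 (fun ω => (Yn ω, Wn ω)) (fun _ => ())
      rw [H_unit hμ] at this
      have a1 : H μ V ≤ H μ (fun ω => (K1 ω, (Yn ω, Wn ω), ())) :=
        H_mono h0 _ _ (by simp [V])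
      have a2 : H μ (fun ω => (K1 ω, ())) ≤ H μ K1 := H_mono h0 _ _ (by simp)
      have a3 : H μ (fun ω => ((Yn ω, Wn ω), ())) ≤ H μ (fun ω => (Yn ω, Wn ω)) :=
        H_mono h0 _ _ (by simp)
      linarith
    have s5 : H μ (fun ω => (Yn ω, Wn ω)) - H μ Wn ≤ ∑ i, condH μ (Ytv i) (Wv i) := by
      refine (chain hμ Ytv Wn).trans (Finset.sum_le_sum fun i _ => ?_)
      have := ssa hμ (Ytv i) Wn (Wv i)
      have a1 : H μ (fun ω => (Ytv i ω, Wn ω)) ≤ H μ (fun ω => (Ytv i ω, Wn ω, Wv i ω)) :=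
        H_mono h0 _ _ (by simp +contextual)
      have a2 : H μ (fun ω => (Wn ω, Wv i ω)) ≤ H μ Wn :=
        H_mono h0 _ _ fun ω ω' h => by
          have := congrFun h i
          simp only [Wn] at this
          simp [h, this]
      unfold condH
      linarith
    have s6 := chain hμ X1v V
    have s7 : H μ (fun ω => (K1 ω, XW ω)) ≤ H μ (fun ω => (fun j => X1v j ω, V ω)) :=
      H_mono h0 _ _ fun ω ω' h => by
        simp only [Prod.mk.injEq, V, funext_iff, XW, Wn] at h ⊢
        exact ⟨h.2.1, fun i => ⟨h.1 i, h.2.2.2 i⟩⟩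
    have s8 : ∀ i, condI μ
          (fun ω => (K1 ω, fun j : {j : Fin n // j ≠ i} => Ytv j.1 ω,
            fun j : {j : Fin n // j ≠ i} => Wv j.1 ω, Ytv i ω))
          (X1v i) (Wv i) = H μ (fun ω => (X1v i ω, Wv i ω)) - H μ (Wv i)
            - (H μ (fun ω => (X1v i ω, V ω)) - H μ V) := by
      intro i
      have sp : ∀ P : Fin n → Prop, (∀ j, P j) ↔ (∀ j : {j : Fin n // j ≠ i}, P j.1) ∧ P i := by
        intro P
        refine ⟨fun h => ⟨fun j => h j.1, h i⟩, fun h j => ?_⟩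
        by_cases hj : j = i
        · exact hj ▸ h.2
        · exact h.1 ⟨j, hj⟩
      have a1 : H μ (fun ω => ((K1 ω, fun j : {j : Fin n // j ≠ i} => Ytv j.1 ω,
            fun j : {j : Fin n // j ≠ i} => Wv j.1 ω, Ytv i ω), Wv i ω)) = H μ V := by
        refine H_congr h0 _ _ fun ω ω' => ?_
        simp only [Prod.mk.injEq, V, funext_iff, Wn, Yn]
        rw [sp fun j => Ytv j ω = Ytv j ω', sp fun j => Wv j ω = Wv j ω']
        tauto
      have a2 : H μ (fun ω => ((K1 ω, fun j : {j : Fin n // j ≠ i} => Ytv j.1 ω,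
            fun j : {j : Fin n // j ≠ i} => Wv j.1 ω, Ytv i ω), X1v i ω, Wv i ω)) =
            H μ (fun ω => (X1v i ω, V ω)) := by
        refine H_congr h0 _ _ fun ω ω' => ?_
        simp only [Prod.mk.injEq, V, funext_iff, Wn, Yn]
        rw [sp fun j => Ytv j ω = Ytv j ω', sp fun j => Wv j ω = Wv j ω']
        tauto
      unfold condI
      rw [a1, a2]
      ring
    rw [Finset.sum_congr rfl fun i _ => s8 i]
    rw [Finset.sum_sub_distrib, Finset.sum_sub_distrib]
    linarith
  refine ⟨part1, ?_⟩
  have hn' : (0 : ℝ) < n := by exact_mod_cast hn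
  have e1 : condH (fun z : Ω × Fin n => μ z.1 / n) (fun z => Ytv z.2 z.1)
        (fun z => (Wv z.2 z.1, z.2)) = (∑ i : Fin n, condH μ (Ytv i) (Wv i)) / n := by
    unfold condH
    rw [H_time hn hμ _ (by simp +contextual), H_time hn hμ _ (by simp +contextual),
      add_sub_add_left_eq_sub, ← sub_div, ← Finset.sum_sub_distrib]
    congr 1
    refine Finset.sum_congr rfl fun i _ => ?_
    congr 1 <;> exact H_congr h0 _ _ (by simp)
  have e2 : condI (fun z : Ω × Fin n => μ z.1 / n)
        (fun z => ((K1 z.1,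
            fun j : Fin n => if j = z.2 then none else some (Ytv j z.1),
            fun j : Fin n => if j = z.2 then none else some (Wv j z.1)),
          Ytv z.2 z.1))
        (fun z => X1v z.2 z.1) (fun z => (Wv z.2 z.1, z.2)) = (∑ i : Fin n, condI μ
          (fun ω => (K1 ω, fun j : {j : Fin n // j ≠ i} => Ytv j.1 ω,
            fun j : {j : Fin n // j ≠ i} => Wv j.1 ω, Ytv i ω))
          (X1v i) (Wv i)) / n := by
    have opt : ∀ {α : Type _} (i : Fin n) (f g : Fin n → α),
        ((∀ j, (if j = i then none else some (f j)) = (if j = i then none else some (g j))) ↔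
          ∀ j : {j : Fin n // j ≠ i}, f j.1 = g j.1) := by
      intro α i f g
      constructor
      · intro h j
        have := h j.1
        simpa [j.2] using this
      · intro h j
        by_cases hj : j = i
        · simp [hj]
        · simp [hj, h ⟨j, hj⟩]
    have opt' : ∀ {α : Type _} (i : Fin n) (f g : Fin n → α),
        ((∀ j, (if j = i then none else some (f j)) = (if j = i then none else some (g j))) ↔
          ∀ j : {j : Fin n // j ≠ i}, f j.1 = g j.1) := by
      intro α i f g
      constructor
      · intro h j
        have := h j.1
        simpa [j.2] using this
      · intro h j
        by_cases hj : j = i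
        · simp [hj]
        · simp [hj, h ⟨j, hj⟩]
    unfold condI
    rw [H_time hn hμ _ (by simp +contextual), H_time hn hμ _ (by simp +contextual),
      H_time hn hμ _ (by simp +contextual), H_time hn hμ _ (by simp +contextual)]
    simp only [Finset.sum_sub_distrib, Finset.sum_add_distrib]
    have b1 : ∀ i, H μ (fun ω => (((K1 ω,
            fun j : Fin n => if j = i then none else some (Ytv j ω),
            fun j : Fin n => if j = i then none else some (Wv j ω)),
          Ytv i ω), Wv i ω, i)) = H μ (fun ω => ((K1 ω, fun j : {j : Fin n // j ≠ i} => Ytv j.1 ω,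
            fun j : {j : Fin n // j ≠ i} => Wv j.1 ω, Ytv i ω), Wv i ω)) := by
      intro i
      refine H_congr h0 _ _ fun ω ω' => ?_
      simp only [Prod.mk.injEq, funext_iff]
      rw [opt i (fun j => Ytv j ω) (fun j => Ytv j ω'),
        opt' i (fun j => Wv j ω) (fun j => Wv j ω')]
      tauto
    have b2 : ∀ i, H μ (fun ω => (((K1 ω,
            fun j : Fin n => if j = i then none else some (Ytv j ω),
            fun j : Fin n => if j = i then none else some (Wv j ω)),
          Ytv i ω), X1v i ω, Wv i ω, i)) =
          H μ (fun ω => ((K1 ω, fun j : {j : Fin n // j ≠ i} => Ytv j.1 ω,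
            fun j : {j : Fin n // j ≠ i} => Wv j.1 ω, Ytv i ω), X1v i ω, Wv i ω)) := by
      intro i
      refine H_congr h0 _ _ fun ω ω' => ?_
      simp only [Prod.mk.injEq, funext_iff]
      rw [opt i (fun j => Ytv j ω) (fun j => Ytv j ω'),
        opt' i (fun j => Wv j ω) (fun j => Wv j ω')]
      tauto
    have b3 : ∀ i, H μ (fun ω => (X1v i ω, Wv i ω, i)) = H μ (fun ω => (X1v i ω, Wv i ω)) :=
      fun i => H_congr h0 _ _ (by simp)
    have b4 : ∀ i, H μ (fun ω => (Wv i ω, i)) = H μ (Wv i) :=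
      fun i => H_congr h0 _ _ (by simp)
    simp_rw [b1, b2, b3, b4]
    ring
  rw [e1, e2]
  exact div_le_div_of_nonneg_right part1 hn'.le
end
end
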